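/- arXiv:1007.5213 — 13 statements merged into one kernel-verified Lean document; each statement's English description precedes it below -/
import Mathlib

section
/- Let s ∈ ℂ be such that K(s) and K̂r(s) := Ŵᵀ * K(s) * V̂ are invertible. Then the pointwise model reduction error admits the three equivalent projector representations: H(s) − Ĥr(s) = C(s) * (K(s))⁻¹ * (1 − P̂(s)) * B(s) = C(s) * (1 − Q̂(s)) * (K(s))⁻¹ * B(s) = C(s) * (1 − Q̂(s)) * (K(s))⁻¹ * (1 − P̂(s)) * B(s). -/
open Matrix

/-- Projector representations of the pointwise model reduction error. -/
theorem error_projector_representations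
    {n m p r : ℕ} (hn : 0 < n) (hm : 0 < m) (hp : 0 < p) (hr : 0 < r)
    (K : ℂ → Matrix (Fin n) (Fin n) ℂ)
    (B : ℂ → Matrix (Fin n) (Fin m) ℂ)
    (C : ℂ → Matrix (Fin p) (Fin n) ℂ)
    (Vh Wh : Matrix (Fin n) (Fin r) ℂ)
    (Krh : ℂ → Matrix (Fin r) (Fin r) ℂ)
    (hKrh : Krh = fun s => Whᵀ * K s * Vh)
    (H Hh : ℂ → Matrix (Fin p) (Fin m) ℂ)
    (hH : H = fun s => C s * (K s)⁻¹ * B s)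
    (hHh : Hh = fun s => C s * Vh * (Krh s)⁻¹ * Whᵀ * B s)
    (Ph Qh : ℂ → Matrix (Fin n) (Fin n) ℂ)
    (hPh : Ph = fun s => K s * Vh * (Krh s)⁻¹ * Whᵀ)
    (hQh : Qh = fun s => Vh * (Krh s)⁻¹ * Whᵀ * K s)
    (s : ℂ) (hK : IsUnit (K s)) (hKr : IsUnit (Krh s)) :
    H s - Hh s = C s * (K s)⁻¹ * (1 - Ph s) * B s ∧
    H s - Hh s = C s * (1 - Qh s) * (K s)⁻¹ * B s ∧
    H s - Hh s = C s * (1 - Qh s) * (K s)⁻¹ * (1 - Ph s) * B s := by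
  have hdet : IsUnit (K s).det := (isUnit_iff_isUnit_det _).mp hK
  have hdetr : IsUnit (Krh s).det := (isUnit_iff_isUnit_det _).mp hKr
  have hG : Whᵀ * (K s * Vh) = Krh s := by simp only [hKrh, Matrix.mul_assoc]
  have hKP : (K s)⁻¹ * Ph s = Vh * (Krh s)⁻¹ * Whᵀ := by
    simp only [hPh, Matrix.mul_assoc, nonsing_inv_mul_cancel_left _ _ hdet]
  have hQK : Qh s * (K s)⁻¹ = Vh * (Krh s)⁻¹ * Whᵀ := by
    simp only [hQh, mul_nonsing_inv_cancel_right _ _ hdet]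
  have hQKP : Qh s * (K s)⁻¹ * Ph s = Vh * (Krh s)⁻¹ * Whᵀ := by
    calc Qh s * (K s)⁻¹ * Ph s
        = Vh * ((Krh s)⁻¹ * ((Whᵀ * (K s * Vh)) * ((Krh s)⁻¹ * Whᵀ))) := by
          rw [hQK]
          simp only [hPh, Matrix.mul_assoc]
      _ = Vh * (Krh s)⁻¹ * Whᵀ := by
          rw [hG, nonsing_inv_mul_cancel_left _ _ hdetr, Matrix.mul_assoc]
  have hdiff : H s - Hh s = C s * ((K s)⁻¹ - Vh * (Krh s)⁻¹ * Whᵀ) * B s := by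
    simp only [hH, hHh, Matrix.mul_sub, Matrix.sub_mul, Matrix.mul_assoc]
  have hright : (K s)⁻¹ * (1 - Ph s) = (K s)⁻¹ - Vh * (Krh s)⁻¹ * Whᵀ := by
    rw [Matrix.mul_sub, Matrix.mul_one, hKP]
  have hleft : (1 - Qh s) * (K s)⁻¹ = (K s)⁻¹ - Vh * (Krh s)⁻¹ * Whᵀ := by
    rw [Matrix.sub_mul, Matrix.one_mul, hQK]
  have hboth : (1 - Qh s) * (K s)⁻¹ * (1 - Ph s) = (K s)⁻¹ - Vh * (Krh s)⁻¹ * Whᵀ := by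
    rw [Matrix.mul_sub, Matrix.mul_one, Matrix.sub_mul, Matrix.one_mul, Matrix.sub_mul, hQKP,
      hQK, hKP, sub_self, sub_zero]
  refine ⟨?_, ?_, ?_⟩
  · rw [hdiff, Matrix.mul_assoc (C s) (K s)⁻¹, hright]
  · rw [hdiff, Matrix.mul_assoc (C s) (1 - Qh s), hleft]
  · rw [hdiff, ← hboth, ← Matrix.mul_assoc, ← Matrix.mul_assoc]
end

section
/- Let s₀ ∈ ℂ be such that K(s₀) and K̂r(s₀) := Ŵᵀ * K(s₀) * V̂ are invertible, and suppose K has a derivative K' at s₀ (HasDerivAt K K' s₀). Then the matrix-valued function s ↦ P̂(s) has a derivative at s₀ equal to (1 − P̂(s₀)) * K' * (K(s₀))⁻¹ * P̂(s₀), and s ↦ Q̂(s) has a derivative at s₀ equal to Q̂(s₀) * (K(s₀))⁻¹ * K' * (1 − Q̂(s₀)). -/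
open Matrix

attribute [local instance] Matrix.normedAddCommGroup Matrix.normedSpace

/-- Product rule for the product of two matrix-valued functions. -/
theorem HasDerivAt.matrix_mul {l m n : Type*} [Fintype l] [Fintype m] [Fintype n]
    {F : ℂ → Matrix l m ℂ} {G : ℂ → Matrix m n ℂ} {F' : Matrix l m ℂ} {G' : Matrix m n ℂ} {s : ℂ}
    (hF : HasDerivAt F F' s) (hG : HasDerivAt G G' s) :
    HasDerivAt (fun z => F z * G z) (F' * G s + F s * G') s := by
  have hF' : ∀ i j, HasDerivAt (fun z => F z i j) (F' i j) s := fun i j =>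
    hasDerivAt_pi.1 (hasDerivAt_pi.1 hF i) j
  have hG' : ∀ i j, HasDerivAt (fun z => G z i j) (G' i j) s := fun i j =>
    hasDerivAt_pi.1 (hasDerivAt_pi.1 hG i) j
  refine hasDerivAt_pi.2 fun i => hasDerivAt_pi.2 fun j => ?_
  simp only [Matrix.add_apply, Matrix.mul_apply, ← Finset.sum_add_distrib]
  exact HasDerivAt.fun_sum fun k _ => (hF' i k).mul (hG' k j)

/-- Derivative of the inverse of a function valued in a finite-dimensional normed algebra. -/
theorem HasDerivAt.ringInverse {R : Type*} [NormedRing R] [NormedAlgebra ℂ R]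
    [FiniteDimensional ℂ R] {F : ℂ → R} {F' : R} {s : ℂ}
    (hF : HasDerivAt F F' s) (hs : IsUnit (F s)) :
    HasDerivAt (fun z => Ring.inverse (F z))
      (-(Ring.inverse (F s) * F' * Ring.inverse (F s))) s := by
  have : CompleteSpace R := FiniteDimensional.complete ℂ R
  obtain ⟨u, hu⟩ := hs
  have hinv : HasFDerivAt Ring.inverse
      (-ContinuousLinearMap.mulLeftRight ℂ R ↑u⁻¹ ↑u⁻¹) (F s) :=
    hu ▸ hasFDerivAt_ringInverse u
  rw [← hu, Ring.inverse_unit]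
  exact hinv.comp_hasDerivAt s hF

/-- Derivative of the inverse of a matrix-valued function. -/
theorem HasDerivAt.matrix_inv {n : Type*} [Fintype n] [DecidableEq n]
    {F : ℂ → Matrix n n ℂ} {F' : Matrix n n ℂ} {s : ℂ}
    (hF : HasDerivAt F F' s) (hs : IsUnit (F s)) :
    HasDerivAt (fun z => (F z)⁻¹) (-((F s)⁻¹ * F' * (F s)⁻¹)) s := by
  let _ : NormedRing (Matrix n n ℂ) := Matrix.linftyOpNormedRing
  let _ : NormedAlgebra ℂ (Matrix n n ℂ) := Matrix.linftyOpNormedAlgebra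
  simp only [Matrix.nonsing_inv_eq_ringInverse]
  exact HasDerivAt.ringInverse hF hs

/-- Derivatives of the skew projectors `P̂` and `Q̂`. -/
theorem skew_projectors_hasDerivAt
    {n m p r : ℕ} (hn : 0 < n) (hm : 0 < m) (hp : 0 < p) (hr : 0 < r)
    (K : ℂ → Matrix (Fin n) (Fin n) ℂ)
    (B : ℂ → Matrix (Fin n) (Fin m) ℂ)
    (C : ℂ → Matrix (Fin p) (Fin n) ℂ)
    (Vh Wh : Matrix (Fin n) (Fin r) ℂ)
    (Krh : ℂ → Matrix (Fin r) (Fin r) ℂ)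
    (hKrh : Krh = fun s => Whᵀ * K s * Vh)
    (Ph Qh : ℂ → Matrix (Fin n) (Fin n) ℂ)
    (hPh : Ph = fun s => K s * Vh * (Krh s)⁻¹ * Whᵀ)
    (hQh : Qh = fun s => Vh * (Krh s)⁻¹ * Whᵀ * K s)
    (s₀ : ℂ) (hK : IsUnit (K s₀)) (hKr : IsUnit (Krh s₀))
    (K' : Matrix (Fin n) (Fin n) ℂ) (hK' : HasDerivAt K K' s₀) :
    HasDerivAt Ph ((1 - Ph s₀) * K' * (K s₀)⁻¹ * Ph s₀) s₀ ∧
    HasDerivAt Qh (Qh s₀ * (K s₀)⁻¹ * K' * (1 - Qh s₀)) s₀ := by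
  have hconst : ∀ {a b : ℕ} (A : Matrix (Fin a) (Fin b) ℂ), HasDerivAt (fun _ => A) 0 s₀ :=
    fun A => hasDerivAt_const s₀ A
  have hdet : IsUnit (K s₀).det := (Matrix.isUnit_iff_isUnit_det _).1 hK
  have hKr' : HasDerivAt Krh (Whᵀ * K' * Vh) s₀ := by
    rw [hKrh]
    simpa using ((hconst Whᵀ).matrix_mul hK').matrix_mul (hconst Vh)
  have hinv := hKr'.matrix_inv hKr
  constructor
  · have h := ((hK'.matrix_mul (hconst Vh)).matrix_mul hinv).matrix_mul (hconst Whᵀ)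
    have hP : (K s₀)⁻¹ * Ph s₀ = Vh * (Krh s₀)⁻¹ * Whᵀ := by
      simp only [hPh, Matrix.mul_assoc, Matrix.nonsing_inv_mul_cancel_left _ _ hdet]
    rw [Matrix.mul_assoc _ (K s₀)⁻¹, hP]
    simp only [hPh]
    convert h using 1
    simp only [Matrix.mul_zero, add_zero, Matrix.add_mul, Matrix.one_mul,
      Matrix.mul_neg, Matrix.neg_mul, Matrix.mul_assoc, sub_eq_add_neg]
  · have h := (((hconst Vh).matrix_mul hinv).matrix_mul (hconst Whᵀ)).matrix_mul hK'
    have hQ : Qh s₀ * (K s₀)⁻¹ = Vh * (Krh s₀)⁻¹ * Whᵀ := by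
      simp only [hQh, Matrix.mul_nonsing_inv_cancel_right _ _ hdet]
    rw [hQ]
    simp only [hQh]
    convert h using 1
    simp only [Matrix.mul_zero, Matrix.zero_mul, zero_add, add_zero, Matrix.mul_add,
      Matrix.mul_one, Matrix.mul_neg, Matrix.neg_mul, Matrix.mul_assoc, sub_eq_add_neg]
    exact add_comm _ _
end

section
/- Let σ, μ ∈ ℂ be such that K(σ), K(μ), K̂r(σ), and K̂r(μ) are invertible. (i) If v̂ is the j-th column of V̂ for some j, b : Fin m → ℂ, and η := K(σ) *ᵥ v̂ − B(σ) *ᵥ b, then (1 − P̂(σ)) *ᵥ (B(σ) *ᵥ b) = −((1 − P̂(σ)) *ᵥ η). (ii) If ŵ is the i-th column of Ŵ for some i, c : Fin p → ℂ, and ξ := (K(μ))ᵀ *ᵥ ŵ − (C(μ))ᵀ *ᵥ c, then the row vector identity (c ᵥ* C(μ)) ᵥ* (1 − Q̂(μ)) = −(ξ ᵥ* (1 − Q̂(μ))) holds, where x ᵥ* M denotes the row-vector–matrix product xᵀM. -/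
open Matrix

/-- The columns of `A * V` are annihilated by the complement of the oblique projector onto their
span. -/
theorem one_sub_right_projector_mul {ι κ R : Type*} [Fintype ι] [DecidableEq ι] [Fintype κ]
    [DecidableEq κ] [CommRing R] (A : Matrix ι ι R) (V W : Matrix ι κ R)
    (h : IsUnit (Wᵀ * A * V)) :
    (1 - A * V * (Wᵀ * A * V)⁻¹ * Wᵀ) * (A * V) = 0 := by
  have hcancel := Matrix.nonsing_inv_mul _ ((Matrix.isUnit_iff_isUnit_det _).mp h)
  rw [Matrix.sub_mul, Matrix.one_mul, Matrix.mul_assoc _ Wᵀ, ← Matrix.mul_assoc Wᵀ,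
    Matrix.mul_assoc (A * V), hcancel, Matrix.mul_one, sub_self]

/-- The rows of `Wᵀ * A` are annihilated by the complement of the oblique projector onto the range
of `V`. -/
theorem mul_one_sub_left_projector {ι κ R : Type*} [Fintype ι] [DecidableEq ι] [Fintype κ]
    [DecidableEq κ] [CommRing R] (A : Matrix ι ι R) (V W : Matrix ι κ R)
    (h : IsUnit (Wᵀ * A * V)) :
    (Wᵀ * A) * (1 - V * (Wᵀ * A * V)⁻¹ * Wᵀ * A) = 0 := by
  have hcancel := Matrix.mul_nonsing_inv _ ((Matrix.isUnit_iff_isUnit_det _).mp h)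
  rw [Matrix.mul_sub, Matrix.mul_one, Matrix.mul_assoc _ Wᵀ, ← Matrix.mul_assoc (Wᵀ * A),
    ← Matrix.mul_assoc (Wᵀ * A), hcancel, Matrix.one_mul, sub_self]

/-- Key residual identities: the projected input direction equals minus the projected
residual (right version), and dually for the left version. -/
theorem residual_projection_identities
    {n m p r : ℕ} (hn : 0 < n) (hm : 0 < m) (hp : 0 < p) (hr : 0 < r)
    (K : ℂ → Matrix (Fin n) (Fin n) ℂ)
    (B : ℂ → Matrix (Fin n) (Fin m) ℂ)
    (C : ℂ → Matrix (Fin p) (Fin n) ℂ)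
    (Vh Wh : Matrix (Fin n) (Fin r) ℂ)
    (Krh : ℂ → Matrix (Fin r) (Fin r) ℂ)
    (hKrh : Krh = fun s => Whᵀ * K s * Vh)
    (Ph Qh : ℂ → Matrix (Fin n) (Fin n) ℂ)
    (hPh : Ph = fun s => K s * Vh * (Krh s)⁻¹ * Whᵀ)
    (hQh : Qh = fun s => Vh * (Krh s)⁻¹ * Whᵀ * K s)
    (σ μ : ℂ)
    (hKσ : IsUnit (K σ)) (hKμ : IsUnit (K μ))
    (hKrσ : IsUnit (Krh σ)) (hKrμ : IsUnit (Krh μ))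
    -- (i) right tangential data
    (vh : Fin n → ℂ) (j : Fin r) (hvh : ∀ i, vh i = Vh i j)
    (b : Fin m → ℂ) (η : Fin n → ℂ)
    (hη : η = K σ *ᵥ vh - B σ *ᵥ b)
    -- (ii) left tangential data
    (wh : Fin n → ℂ) (i : Fin r) (hwh : ∀ k, wh k = Wh k i)
    (c : Fin p → ℂ) (ξ : Fin n → ℂ)
    (hξ : ξ = (K μ)ᵀ *ᵥ wh - (C μ)ᵀ *ᵥ c) :
    (1 - Ph σ) *ᵥ (B σ *ᵥ b) = -((1 - Ph σ) *ᵥ η) ∧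
    (c ᵥ* C μ) ᵥ* (1 - Qh μ) = -(ξ ᵥ* (1 - Qh μ)) := by
  subst hKrh hPh hQh hη hξ
  have hv : vh = Vh *ᵥ Pi.single j 1 := by
    ext k
    simp [hvh]
  have hw : wh = Pi.single i 1 ᵥ* Whᵀ := by
    ext k
    simp [hwh]
  constructor
  · rw [Matrix.mulVec_sub, hv, Matrix.mulVec_mulVec (Pi.single j 1) (K σ) Vh,
      Matrix.mulVec_mulVec (Pi.single j 1), one_sub_right_projector_mul _ _ _ hKrσ,
      Matrix.zero_mulVec, zero_sub, neg_neg]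
  · rw [Matrix.mulVec_transpose, Matrix.mulVec_transpose, Matrix.sub_vecMul, hw,
      Matrix.vecMul_vecMul (Pi.single i 1) Whᵀ (K μ), Matrix.vecMul_vecMul (Pi.single i 1),
      mul_one_sub_left_projector _ _ _ hKrμ, Matrix.vecMul_zero, zero_sub, neg_neg]
end

section
/- Let σ, μ ∈ ℂ be such that K(σ), K(μ), K̂r(σ), and K̂r(μ) are invertible. (i) If v̂ is the j-th column of V̂, b : Fin m → ℂ, and η := K(σ) *ᵥ v̂ − B(σ) *ᵥ b, then Ĥr(σ) *ᵥ b − H(σ) *ᵥ b = C(σ) * (K(σ))⁻¹ * (1 − P̂(σ)) *ᵥ η. (ii) If ŵ is the i-th column of Ŵ, c : Fin p → ℂ, and ξ := (K(μ))ᵀ *ᵥ ŵ − (C(μ))ᵀ *ᵥ c, then the row vectors satisfy c ᵥ* Ĥr(μ) − c ᵥ* H(μ) = ξ ᵥ* ((1 − Q̂(μ)) * (K(μ))⁻¹ * B(μ)), where x ᵥ* M denotes the row-vector–matrix product xᵀM. -/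
open Matrix

section ResidualAnnihilation

variable {R ι κ : Type*} [CommRing R] [Fintype ι] [DecidableEq ι] [Fintype κ] [DecidableEq κ]

/-- The skew projector `K V (Wᵀ K V)⁻¹ Wᵀ` fixes the columns of `K V`. -/
theorem one_sub_skewProjector_mul (K : Matrix ι ι R) (V W : Matrix ι κ R)
    (h : IsUnit (Wᵀ * K * V)) :
    (1 - K * V * (Wᵀ * K * V)⁻¹ * Wᵀ) * (K * V) = 0 := by
  have h' := Matrix.nonsing_inv_mul _ ((Matrix.isUnit_iff_isUnit_det _).mp h)
  have e : K * V * (Wᵀ * K * V)⁻¹ * Wᵀ * (K * V)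
      = K * V * ((Wᵀ * K * V)⁻¹ * (Wᵀ * K * V)) := by
    simp only [Matrix.mul_assoc]
  rw [Matrix.sub_mul, e, h', Matrix.one_mul, Matrix.mul_one, sub_self]

/-- The skew projector `V (Wᵀ K V)⁻¹ Wᵀ K` fixes the rows of `Wᵀ K`. -/
theorem mul_one_sub_skewProjector (K : Matrix ι ι R) (V W : Matrix ι κ R)
    (h : IsUnit (Wᵀ * K * V)) :
    Wᵀ * K * (1 - V * (Wᵀ * K * V)⁻¹ * Wᵀ * K) = 0 := by
  have h' := Matrix.mul_nonsing_inv _ ((Matrix.isUnit_iff_isUnit_det _).mp h)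
  have e : Wᵀ * K * (V * (Wᵀ * K * V)⁻¹ * Wᵀ * K)
      = (Wᵀ * K * V) * (Wᵀ * K * V)⁻¹ * (Wᵀ * K) := by
    simp only [Matrix.mul_assoc]
  rw [Matrix.mul_sub, e, h', Matrix.one_mul, Matrix.mul_one, sub_self]

end ResidualAnnihilation

/-- Tangential interpolation errors expressed through the residuals of the inexact
solves (right and left versions). -/
theorem tangential_error_residual_representations
    {n m p r : ℕ} (hn : 0 < n) (hm : 0 < m) (hp : 0 < p) (hr : 0 < r)
    (K : ℂ → Matrix (Fin n) (Fin n) ℂ)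
    (B : ℂ → Matrix (Fin n) (Fin m) ℂ)
    (C : ℂ → Matrix (Fin p) (Fin n) ℂ)
    (Vh Wh : Matrix (Fin n) (Fin r) ℂ)
    (Krh : ℂ → Matrix (Fin r) (Fin r) ℂ)
    (hKrh : Krh = fun s => Whᵀ * K s * Vh)
    (H Hh : ℂ → Matrix (Fin p) (Fin m) ℂ)
    (hH : H = fun s => C s * (K s)⁻¹ * B s)
    (hHh : Hh = fun s => C s * Vh * (Krh s)⁻¹ * Whᵀ * B s)
    (Ph Qh : ℂ → Matrix (Fin n) (Fin n) ℂ)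
    (hPh : Ph = fun s => K s * Vh * (Krh s)⁻¹ * Whᵀ)
    (hQh : Qh = fun s => Vh * (Krh s)⁻¹ * Whᵀ * K s)
    (σ μ : ℂ)
    (hKσ : IsUnit (K σ)) (hKμ : IsUnit (K μ))
    (hKrσ : IsUnit (Krh σ)) (hKrμ : IsUnit (Krh μ))
    -- (i) right tangential data
    (vh : Fin n → ℂ) (j : Fin r) (hvh : ∀ i, vh i = Vh i j)
    (b : Fin m → ℂ) (η : Fin n → ℂ)
    (hη : η = K σ *ᵥ vh - B σ *ᵥ b)
    -- (ii) left tangential data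
    (wh : Fin n → ℂ) (i : Fin r) (hwh : ∀ k, wh k = Wh k i)
    (c : Fin p → ℂ) (ξ : Fin n → ℂ)
    (hξ : ξ = (K μ)ᵀ *ᵥ wh - (C μ)ᵀ *ᵥ c) :
    Hh σ *ᵥ b - H σ *ᵥ b = (C σ * (K σ)⁻¹ * (1 - Ph σ)) *ᵥ η ∧
    c ᵥ* Hh μ - c ᵥ* H μ = ξ ᵥ* ((1 - Qh μ) * (K μ)⁻¹ * B μ) := by
  have hv : vh = Vh *ᵥ Pi.single j 1 := by
    ext k
    simp [hvh]
  have hw : wh = Pi.single i 1 ᵥ* Whᵀ := by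
    ext k
    simp [hwh]
  subst hKrh hH hHh hPh hQh
  dsimp only at hKrσ hKrμ ⊢
  constructor
  · have hres : (1 - K σ * Vh * (Whᵀ * K σ * Vh)⁻¹ * Whᵀ) *ᵥ (K σ *ᵥ vh) = 0 := by
      rw [hv, mulVec_mulVec, mulVec_mulVec, Matrix.mul_assoc _ (K σ) Vh,
        one_sub_skewProjector_mul _ _ _ hKrσ, zero_mulVec]
    have hK := Matrix.nonsing_inv_mul _ ((Matrix.isUnit_iff_isUnit_det _).mp hKσ)
    have hC : C σ * (K σ)⁻¹ * (1 - K σ * Vh * (Whᵀ * K σ * Vh)⁻¹ * Whᵀ) * B σ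
        = C σ * (K σ)⁻¹ * B σ - C σ * Vh * (Whᵀ * K σ * Vh)⁻¹ * Whᵀ * B σ := by
      have e : C σ * (K σ)⁻¹ * (K σ * Vh * (Whᵀ * K σ * Vh)⁻¹ * Whᵀ)
          = C σ * ((K σ)⁻¹ * K σ) * Vh * (Whᵀ * K σ * Vh)⁻¹ * Whᵀ := by
        simp only [Matrix.mul_assoc]
      rw [Matrix.mul_sub, Matrix.sub_mul, e, hK, Matrix.mul_one, Matrix.mul_one]
    rw [hη, mulVec_sub, ← mulVec_mulVec (K σ *ᵥ vh), hres, mulVec_zero, mulVec_mulVec, hC,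
      sub_mulVec]
    abel
  · have hres : (wh ᵥ* K μ) ᵥ* (1 - Vh * (Whᵀ * K μ * Vh)⁻¹ * Whᵀ * K μ) = 0 := by
      rw [hw, vecMul_vecMul, vecMul_vecMul, ← Matrix.mul_assoc Whᵀ (K μ),
        mul_one_sub_skewProjector _ _ _ hKrμ, vecMul_zero]
    have hK := Matrix.mul_nonsing_inv _ ((Matrix.isUnit_iff_isUnit_det _).mp hKμ)
    have hB : C μ * ((1 - Vh * (Whᵀ * K μ * Vh)⁻¹ * Whᵀ * K μ) * (K μ)⁻¹ * B μ)
        = C μ * (K μ)⁻¹ * B μ - C μ * Vh * (Whᵀ * K μ * Vh)⁻¹ * Whᵀ * B μ := by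
      rw [Matrix.sub_mul, Matrix.mul_assoc _ (K μ) (K μ)⁻¹, hK, Matrix.one_mul, Matrix.mul_one,
        Matrix.sub_mul, Matrix.mul_sub]
      simp only [Matrix.mul_assoc]
    rw [hξ, mulVec_transpose, mulVec_transpose, sub_vecMul, vecMul_vecMul c, hB,
      Matrix.mul_assoc (1 - _), ← vecMul_vecMul (wh ᵥ* K μ), hres, zero_vecMul, vecMul_sub]
    abel
end

section
/- Let μ ∈ ℂ be such that K(μ) and K̂r(μ) are invertible. Suppose v̂ is a column of V̂, ŵ is a column of Ŵ, b : Fin m → ℂ, c : Fin p → ℂ, and set η := K(μ) *ᵥ v̂ − B(μ) *ᵥ b and ξ := (K(μ))ᵀ *ᵥ ŵ − (C(μ))ᵀ *ᵥ c. Then the bitangential error satisfies the identities c ⬝ᵥ (H(μ) *ᵥ b) − c ⬝ᵥ (Ĥr(μ) *ᵥ b) = ξ ⬝ᵥ ((1 − Q̂(μ)) * (K(μ))⁻¹ * (1 − P̂(μ)) *ᵥ η) = ξ ⬝ᵥ ((K(μ))⁻¹ * (1 − P̂(μ)) *ᵥ η) = ξ ⬝ᵥ ((1 − Q̂(μ))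 * (K(μ))⁻¹ *ᵥ η), where ⬝ᵥ is the bilinear (non-conjugated) dot product. -/
open Matrix

section PetrovGalerkin

variable {R n r : Type*} [CommRing R] [Fintype n] [DecidableEq n] [Fintype r]
  {A : Matrix n n R} {V W : Matrix n r R}

/-- The Petrov-Galerkin approximation of `A⁻¹` is exact on the image of `A * V`. -/
lemma inv_sub_petrovGalerkin_mul [DecidableEq r] (hA : IsUnit A)
    (hr : IsUnit (Wᵀ * A * V)) :
    (A⁻¹ - V * (Wᵀ * A * V)⁻¹ * Wᵀ) * (A * V) = 0 := by
  have h : V * (Wᵀ * A * V)⁻¹ * Wᵀ * (A * V) = V := by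
    rw [Matrix.mul_assoc _ Wᵀ, ← Matrix.mul_assoc Wᵀ, Matrix.mul_assoc V,
      nonsing_inv_mul _ ((isUnit_iff_isUnit_det _).1 hr), Matrix.mul_one]
  rw [Matrix.sub_mul, h,
    nonsing_inv_mul_cancel_left _ _ ((isUnit_iff_isUnit_det _).1 hA), sub_self]

lemma mul_inv_sub_petrovGalerkin [DecidableEq r] (hA : IsUnit A)
    (hr : IsUnit (Wᵀ * A * V)) :
    Wᵀ * A * (A⁻¹ - V * (Wᵀ * A * V)⁻¹ * Wᵀ) = 0 := by
  have h : Wᵀ * A * (V * (Wᵀ * A * V)⁻¹ * Wᵀ) = Wᵀ := by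
    rw [← Matrix.mul_assoc, ← Matrix.mul_assoc,
      mul_nonsing_inv _ ((isUnit_iff_isUnit_det _).1 hr), Matrix.one_mul]
  rw [Matrix.mul_sub, h,
    mul_nonsing_inv_cancel_right _ _ ((isUnit_iff_isUnit_det _).1 hA), sub_self]

lemma inv_mul_one_sub_petrovGalerkin (hA : IsUnit A) (S : Matrix r r R) :
    A⁻¹ * (1 - A * V * S * Wᵀ) = A⁻¹ - V * S * Wᵀ := by
  rw [Matrix.mul_sub, Matrix.mul_one, Matrix.mul_assoc A, Matrix.mul_assoc A,
    nonsing_inv_mul_cancel_left _ _ ((isUnit_iff_isUnit_det _).1 hA)]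

lemma one_sub_petrovGalerkin_mul_inv (hA : IsUnit A) (S : Matrix r r R) :
    (1 - V * S * Wᵀ * A) * A⁻¹ = A⁻¹ - V * S * Wᵀ := by
  rw [Matrix.sub_mul, Matrix.one_mul,
    mul_nonsing_inv_cancel_right _ _ ((isUnit_iff_isUnit_det _).1 hA)]

lemma one_sub_mul_inv_mul_one_sub_petrovGalerkin [DecidableEq r] (hA : IsUnit A)
    (hr : IsUnit (Wᵀ * A * V)) :
    (1 - V * (Wᵀ * A * V)⁻¹ * Wᵀ * A) * A⁻¹ * (1 - A * V * (Wᵀ * A * V)⁻¹ * Wᵀ) =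
      A⁻¹ - V * (Wᵀ * A * V)⁻¹ * Wᵀ := by
  rw [one_sub_petrovGalerkin_mul_inv hA, Matrix.mul_sub, Matrix.mul_one,
    Matrix.mul_assoc (A * V), ← Matrix.mul_assoc _ (A * V), inv_sub_petrovGalerkin_mul hA hr,
    Matrix.zero_mul, sub_zero]

end PetrovGalerkin

lemma residual_dotProduct_mulVec_residual {R n m p : Type*} [CommRing R] [Fintype n] [Fintype m]
    [Fintype p] {A D : Matrix n n R} (B : Matrix n m R) (C : Matrix p n R) {v w : n → R}
    (b : m → R) (c : p → R) (hv : D *ᵥ (A *ᵥ v) = 0) (hw : (w ᵥ* A) ᵥ* D = 0) :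
    (Aᵀ *ᵥ w - Cᵀ *ᵥ c) ⬝ᵥ (D *ᵥ (A *ᵥ v - B *ᵥ b)) = c ⬝ᵥ ((C * D * B) *ᵥ b) := by
  rw [mulVec_sub, hv, zero_sub, dotProduct_neg, dotProduct_mulVec, mulVec_transpose,
    mulVec_transpose, sub_vecMul, hw, zero_sub, neg_dotProduct, neg_neg]
  simp only [← mulVec_mulVec, dotProduct_mulVec]

/-- Bitangential error identities at a common interpolation point `μ`. -/
theorem bitangential_error_identities
    {n m p r : ℕ} (hn : 0 < n) (hm : 0 < m) (hp : 0 < p) (hr : 0 < r)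
    (K : ℂ → Matrix (Fin n) (Fin n) ℂ)
    (B : ℂ → Matrix (Fin n) (Fin m) ℂ)
    (C : ℂ → Matrix (Fin p) (Fin n) ℂ)
    (Vh Wh : Matrix (Fin n) (Fin r) ℂ)
    (Krh : ℂ → Matrix (Fin r) (Fin r) ℂ)
    (hKrh : Krh = fun s => Whᵀ * K s * Vh)
    (H Hh : ℂ → Matrix (Fin p) (Fin m) ℂ)
    (hH : H = fun s => C s * (K s)⁻¹ * B s)
    (hHh : Hh = fun s => C s * Vh * (Krh s)⁻¹ * Whᵀ * B s)
    (Ph Qh : ℂ → Matrix (Fin n) (Fin n) ℂ)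
    (hPh : Ph = fun s => K s * Vh * (Krh s)⁻¹ * Whᵀ)
    (hQh : Qh = fun s => Vh * (Krh s)⁻¹ * Whᵀ * K s)
    (μ : ℂ) (hKμ : IsUnit (K μ)) (hKrμ : IsUnit (Krh μ))
    (vh : Fin n → ℂ) (j : Fin r) (hvh : ∀ i, vh i = Vh i j)
    (wh : Fin n → ℂ) (i : Fin r) (hwh : ∀ k, wh k = Wh k i)
    (b : Fin m → ℂ) (c : Fin p → ℂ) (η ξ : Fin n → ℂ)
    (hη : η = K μ *ᵥ vh - B μ *ᵥ b)
    (hξ : ξ = (K μ)ᵀ *ᵥ wh - (C μ)ᵀ *ᵥ c) :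
    c ⬝ᵥ (H μ *ᵥ b) - c ⬝ᵥ (Hh μ *ᵥ b) =
        ξ ⬝ᵥ (((1 - Qh μ) * (K μ)⁻¹ * (1 - Ph μ)) *ᵥ η) ∧
    c ⬝ᵥ (H μ *ᵥ b) - c ⬝ᵥ (Hh μ *ᵥ b) = ξ ⬝ᵥ (((K μ)⁻¹ * (1 - Ph μ)) *ᵥ η) ∧
    c ⬝ᵥ (H μ *ᵥ b) - c ⬝ᵥ (Hh μ *ᵥ b) = ξ ⬝ᵥ (((1 - Qh μ) * (K μ)⁻¹) *ᵥ η) := by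
  obtain rfl : vh = Vh *ᵥ Pi.single j 1 := by
    ext k
    simp [hvh]
  obtain rfl : wh = Pi.single i 1 ᵥ* Whᵀ := by
    ext k
    simp [hwh]
  subst hKrh hH hHh hPh hQh hη hξ
  have key := residual_dotProduct_mulVec_residual (A := K μ)
    (D := (K μ)⁻¹ - Vh * (Whᵀ * K μ * Vh)⁻¹ * Whᵀ) (v := Vh *ᵥ Pi.single j 1)
    (w := Pi.single i 1 ᵥ* Whᵀ) (B μ) (C μ) b c
    (by rw [mulVec_mulVec _ (K μ), mulVec_mulVec, inv_sub_petrovGalerkin_mul hKμ hKrμ, zero_mulVec])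
    (by rw [vecMul_vecMul _ Whᵀ, vecMul_vecMul, mul_inv_sub_petrovGalerkin hKμ hKrμ, vecMul_zero])
  rw [one_sub_mul_inv_mul_one_sub_petrovGalerkin hKμ hKrμ, inv_mul_one_sub_petrovGalerkin hKμ,
    one_sub_petrovGalerkin_mul_inv hKμ, key, and_self, and_self, ← dotProduct_sub, ← sub_mulVec]
  simp only [Matrix.mul_sub, Matrix.sub_mul, Matrix.mul_assoc]
end

section
/- (Theorem 1, right tangential bound.) Let σ ∈ ℂ be such that K(σ) and K̂r(σ) are invertible. Let v̂ be the j-th column of V̂, b : Fin m → ℂ, and η := K(σ) *ᵥ v̂ − B(σ) *ᵥ b. Let Π̂ be the orthogonal projector onto the column span of Ŵ, i.e. Π̂ᴴ = Π̂, Π̂ * Π̂ = Π̂, Π̂ * Ŵ = Ŵ, and Π̂ = Ŵ * X for some matrix X. Then ‖Ĥr(σ) *ᵥ b − H(σ) *ᵥ b‖ ≤ ‖C(σ) * (K(σ))⁻¹ * (1 − Π̂)‖ · ‖1 − P̂(σ)‖ · ‖η‖. -/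
open Matrix

/-- Euclidean norm of a vector. -/
noncomputable def vnorm {k : ℕ} (x : Fin k → ℂ) : ℝ :=
  ‖(WithLp.equiv 2 (Fin k → ℂ)).symm x‖

/-- Spectral (Euclidean operator) norm of a matrix. -/
noncomputable def mnorm {k l : ℕ} (M : Matrix (Fin k) (Fin l) ℂ) : ℝ :=
  ‖LinearMap.toContinuousLinearMap (Matrix.toEuclideanLin M)‖

theorem vnorm_mulVec_le {k l : ℕ} (M : Matrix (Fin k) (Fin l) ℂ) (x : Fin l → ℂ) :
    vnorm (M *ᵥ x) ≤ mnorm M * vnorm x :=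
  (LinearMap.toContinuousLinearMap (Matrix.toEuclideanLin M)).le_opNorm (WithLp.toLp 2 x)

theorem mnorm_nonneg {k l : ℕ} (M : Matrix (Fin k) (Fin l) ℂ) : 0 ≤ mnorm M :=
  norm_nonneg _

/-- Theorem 1 (right tangential bound). -/
theorem right_tangential_interpolation_error_bound
    {n m p r : ℕ} (hn : 0 < n) (hm : 0 < m) (hp : 0 < p) (hr : 0 < r)
    (K : ℂ → Matrix (Fin n) (Fin n) ℂ)
    (B : ℂ → Matrix (Fin n) (Fin m) ℂ)
    (C : ℂ → Matrix (Fin p) (Fin n) ℂ)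
    (Vh Wh : Matrix (Fin n) (Fin r) ℂ)
    (Krh : ℂ → Matrix (Fin r) (Fin r) ℂ)
    (hKrh : Krh = fun s => Whᴴ * K s * Vh)
    (H Hh : ℂ → Matrix (Fin p) (Fin m) ℂ)
    (hH : H = fun s => C s * (K s)⁻¹ * B s)
    (hHh : Hh = fun s => C s * Vh * (Krh s)⁻¹ * Whᴴ * B s)
    (Ph : ℂ → Matrix (Fin n) (Fin n) ℂ)
    (hPh : Ph = fun s => K s * Vh * (Krh s)⁻¹ * Whᴴ)
    (σ : ℂ) (hKσ : IsUnit (K σ)) (hKrσ : IsUnit (Krh σ))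
    (vh : Fin n → ℂ) (j : Fin r) (hvh : ∀ i, vh i = Vh i j)
    (b : Fin m → ℂ) (η : Fin n → ℂ)
    (hη : η = K σ *ᵥ vh - B σ *ᵥ b)
    -- `Pi` is the orthogonal projector onto the column span of `Wh`
    (Pi : Matrix (Fin n) (Fin n) ℂ)
    (hPi_herm : Piᴴ = Pi) (hPi_idem : Pi * Pi = Pi)
    (hPi_fix : Pi * Wh = Wh) (hPi_ran : ∃ X : Matrix (Fin r) (Fin n) ℂ, Pi = Wh * X) :
    vnorm (Hh σ *ᵥ b - H σ *ᵥ b) ≤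
      mnorm (C σ * (K σ)⁻¹ * (1 - Pi)) * mnorm (1 - Ph σ) * vnorm η := by
  subst hKrh hH hHh hPh
  obtain ⟨X, hX⟩ := hPi_ran
  have hKdet := (Matrix.isUnit_iff_isUnit_det _).mp hKσ
  have hKrdet := (Matrix.isUnit_iff_isUnit_det _).mp hKrσ
  have hv : vh = Vh *ᵥ _root_.Pi.single j 1 := by
    ext i
    simp [hvh]
  beta_reduce at hKrσ hKrdet ⊢
  set M := Whᴴ * K σ * Vh with hM
  set P := K σ * Vh * M⁻¹ * Whᴴ with hP
  have hPKV : P * (K σ * Vh) = K σ * Vh := by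
    calc P * (K σ * Vh) = K σ * Vh * (M⁻¹ * M) := by simp only [hP, hM, Matrix.mul_assoc]
      _ = K σ * Vh := by rw [Matrix.nonsing_inv_mul _ hKrdet, Matrix.mul_one]
  have hWP : Whᴴ * P = Whᴴ := by
    calc Whᴴ * P = M * M⁻¹ * Whᴴ := by simp only [hP, hM, Matrix.mul_assoc]
      _ = Whᴴ := by rw [Matrix.mul_nonsing_inv _ hKrdet, Matrix.one_mul]
  have hPiP : Pi * P = Pi := by
    rw [← hPi_herm, hX, Matrix.conjTranspose_mul, Matrix.mul_assoc, hWP]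
  have hPη : (1 - P) *ᵥ η = -((1 - P) *ᵥ (B σ *ᵥ b)) := by
    have h0 : (1 - P) * (K σ * Vh) = 0 := by
      rw [Matrix.sub_mul, hPKV, Matrix.one_mul, sub_self]
    rw [hη, hv, Matrix.mulVec_sub, Matrix.mulVec_mulVec _ (K σ), Matrix.mulVec_mulVec _ (1 - P),
      h0, Matrix.zero_mulVec, zero_sub]
  have hproj : (1 - Pi) * (1 - P) = 1 - P := by
    have h0 : Pi * (1 - P) = 0 := by rw [Matrix.mul_sub, hPiP, Matrix.mul_one, sub_self]
    rw [Matrix.sub_mul, h0, Matrix.one_mul, sub_zero]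
  have hKP : (K σ)⁻¹ * P = Vh * M⁻¹ * Whᴴ := by
    simp only [hP, Matrix.mul_assoc]
    rw [Matrix.nonsing_inv_mul_cancel_left _ _ hKdet]
  have herr : (C σ * Vh * M⁻¹ * Whᴴ * B σ) *ᵥ b - (C σ * (K σ)⁻¹ * B σ) *ᵥ b =
      (C σ * (K σ)⁻¹ * (1 - Pi)) *ᵥ ((1 - P) *ᵥ η) := by
    have hCP : C σ * (K σ)⁻¹ * P = C σ * Vh * M⁻¹ * Whᴴ := by
      rw [Matrix.mul_assoc, hKP]
      simp only [Matrix.mul_assoc]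
    rw [Matrix.mulVec_mulVec η, Matrix.mul_assoc (C σ * (K σ)⁻¹), hproj,
      ← Matrix.mulVec_mulVec η, hPη, Matrix.mulVec_neg, Matrix.mulVec_mulVec, Matrix.mulVec_mulVec,
      Matrix.mul_sub, Matrix.mul_one, hCP, Matrix.sub_mul, Matrix.sub_mulVec, neg_sub]
  rw [herr, mul_assoc]
  exact (vnorm_mulVec_le _ _).trans
    (mul_le_mul_of_nonneg_left (vnorm_mulVec_le _ _) (mnorm_nonneg _))
end

section
/- Let s₀ ∈ ℂ be such that K(s₀) and K̂r(s₀) are invertible. Suppose the functions s ↦ C(s) * (K(s))⁻¹, s ↦ (K(s))⁻¹ * B(s), s ↦ (K(s))⁻¹, and K all have derivatives at s₀, denoted D₁, D₂, D₃, and K' respectively. Then the error function s ↦ H(s) − Ĥr(s) has a derivative at s₀ equal to D₁ * (1 − P̂(s₀)) * B(s₀) + C(s₀) * (1 − Q̂(s₀)) * D₂ − C(s₀) * (1 − Q̂(s₀)) * D₃ * (1 − P̂(s₀)) * B(s₀). -/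
open Matrix

attribute [local instance] Matrix.normedAddCommGroup Matrix.normedSpace

theorem Matrix.hasDerivAt_iff_entries {k l : ℕ} {A : ℂ → Matrix (Fin k) (Fin l) ℂ}
    {A' : Matrix (Fin k) (Fin l) ℂ} {z : ℂ} :
    HasDerivAt A A' z ↔ ∀ i j, HasDerivAt (fun s => A s i j) (A' i j) z :=
  hasDerivAt_pi.trans (forall_congr' fun _ => hasDerivAt_pi)

theorem HasDerivAt.continuousAt_matrix {k l : ℕ} {A : ℂ → Matrix (Fin k) (Fin l) ℂ}
    {A' : Matrix (Fin k) (Fin l) ℂ} {z : ℂ} (hA : HasDerivAt A A' z) : ContinuousAt A z :=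
  continuousAt_pi.2 fun i => continuousAt_pi.2 fun j =>
    (Matrix.hasDerivAt_iff_entries.1 hA i j).continuousAt

theorem Matrix.hasDerivAt_iff_tendsto_slope {k l : ℕ} {A : ℂ → Matrix (Fin k) (Fin l) ℂ}
    {A' : Matrix (Fin k) (Fin l) ℂ} {z : ℂ} :
    HasDerivAt A A' z ↔
      Filter.Tendsto (fun s => (s - z)⁻¹ • (A s - A z)) (nhdsWithin z {z}ᶜ) (nhds A') := by
  rw [Matrix.hasDerivAt_iff_entries]
  refine Iff.trans ?_ (tendsto_pi_nhds.trans (forall_congr' fun _ => tendsto_pi_nhds)).symm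
  simp only [_root_.hasDerivAt_iff_tendsto_slope]
  rfl

theorem HasDerivAt.matrix_mul_s9 {k l q : ℕ} {A : ℂ → Matrix (Fin k) (Fin l) ℂ}
    {A' : Matrix (Fin k) (Fin l) ℂ} {M : ℂ → Matrix (Fin l) (Fin q) ℂ}
    {M' : Matrix (Fin l) (Fin q) ℂ} {z : ℂ} (hA : HasDerivAt A A' z) (hM : HasDerivAt M M' z) :
    HasDerivAt (fun s => A s * M s) (A' * M z + A z * M') z := by
  rw [Matrix.hasDerivAt_iff_entries] at hA hM ⊢
  intro i j
  simp only [Matrix.mul_apply, Matrix.add_apply, ← Finset.sum_add_distrib]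
  exact HasDerivAt.fun_sum fun x _ => (hA i x).mul (hM x j)

theorem HasDerivAt.eventually_isUnit_matrix {k : ℕ} {A : ℂ → Matrix (Fin k) (Fin k) ℂ}
    {A' : Matrix (Fin k) (Fin k) ℂ} {z : ℂ} (hA : HasDerivAt A A' z) (h : IsUnit (A z)) :
    ∀ᶠ s in nhds z, IsUnit (A s) := by
  have hc : ContinuousAt (fun s => (A s).det) z :=
    (continuous_id.matrix_det (n := Fin k) (R := ℂ)).continuousAt.comp hA.continuousAt_matrix
  simp only [Matrix.isUnit_iff_isUnit_det, isUnit_iff_ne_zero] at h ⊢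
  exact hc.eventually_ne h

theorem HasDerivAt.matrix_inv_s9 {k : ℕ} {A : ℂ → Matrix (Fin k) (Fin k) ℂ}
    {A' : Matrix (Fin k) (Fin k) ℂ} {z : ℂ} (hA : HasDerivAt A A' z) (h : IsUnit (A z)) :
    HasDerivAt (fun s => (A s)⁻¹) (-((A z)⁻¹ * A' * (A z)⁻¹)) z := by
  have hdet : (A z).det ≠ 0 := by
    simpa [Matrix.isUnit_iff_isUnit_det] using h
  have hinv : ContinuousAt (fun s => (A s)⁻¹) z := by
    refine ContinuousAt.comp (g := Inv.inv) (continuousAt_matrix_inv _ ?_) hA.continuousAt_matrix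
    simpa using NormedRing.inverse_continuousAt (Units.mk0 _ hdet)
  have hU := hA.eventually_isUnit_matrix h
  rw [Matrix.hasDerivAt_iff_tendsto_slope] at hA ⊢
  have hlim := ((hinv.tendsto.mono_left nhdsWithin_le_nhds).mul hA).mul
    (tendsto_const_nhds (x := (A z)⁻¹)) |>.neg
  refine hlim.congr' ?_
  filter_upwards [nhdsWithin_le_nhds hU] with s hs
  simp only [Matrix.mul_smul, Matrix.smul_mul, ← smul_neg]
  congr 1
  have h₁ := Matrix.nonsing_inv_mul _ ((Matrix.isUnit_iff_isUnit_det _).1 hs)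
  have h₂ := Matrix.mul_nonsing_inv _ ((Matrix.isUnit_iff_isUnit_det _).1 h)
  rw [mul_sub, sub_mul, h₁, mul_assoc, h₂]
  simp

/-- Derivative of the pointwise model reduction error `H - Ĥr`. -/
theorem error_hasDerivAt
    {n m p r : ℕ} (hn : 0 < n) (hm : 0 < m) (hp : 0 < p) (hr : 0 < r)
    (K : ℂ → Matrix (Fin n) (Fin n) ℂ)
    (B : ℂ → Matrix (Fin n) (Fin m) ℂ)
    (C : ℂ → Matrix (Fin p) (Fin n) ℂ)
    (Vh Wh : Matrix (Fin n) (Fin r) ℂ)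
    (Krh : ℂ → Matrix (Fin r) (Fin r) ℂ)
    (hKrh : Krh = fun s => Whᵀ * K s * Vh)
    (H Hh : ℂ → Matrix (Fin p) (Fin m) ℂ)
    (hH : H = fun s => C s * (K s)⁻¹ * B s)
    (hHh : Hh = fun s => C s * Vh * (Krh s)⁻¹ * Whᵀ * B s)
    (Ph Qh : ℂ → Matrix (Fin n) (Fin n) ℂ)
    (hPh : Ph = fun s => K s * Vh * (Krh s)⁻¹ * Whᵀ)
    (hQh : Qh = fun s => Vh * (Krh s)⁻¹ * Whᵀ * K s)
    (s₀ : ℂ) (hK : IsUnit (K s₀)) (hKr : IsUnit (Krh s₀))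
    (D₁ : Matrix (Fin p) (Fin n) ℂ)
    (D₂ : Matrix (Fin n) (Fin m) ℂ)
    (D₃ K' : Matrix (Fin n) (Fin n) ℂ)
    (hD₁ : HasDerivAt (fun s => C s * (K s)⁻¹) D₁ s₀)
    (hD₂ : HasDerivAt (fun s => (K s)⁻¹ * B s) D₂ s₀)
    (hD₃ : HasDerivAt (fun s => (K s)⁻¹) D₃ s₀)
    (hK' : HasDerivAt K K' s₀) :
    HasDerivAt (fun s => H s - Hh s)
      (D₁ * (1 - Ph s₀) * B s₀ + C s₀ * (1 - Qh s₀) * D₂ -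
        C s₀ * (1 - Qh s₀) * D₃ * (1 - Ph s₀) * B s₀) s₀ := by
  subst hKrh hH hHh hPh hQh
  simp only at hKr ⊢
  have hdK := (Matrix.isUnit_iff_isUnit_det _).1 hK
  have hD₃eq : D₃ = -((K s₀)⁻¹ * K' * (K s₀)⁻¹) := hD₃.unique (hK'.matrix_inv_s9 hK)
  have hKr' : HasDerivAt (fun s => Whᵀ * K s * Vh) (Whᵀ * K' * Vh) s₀ := by
    simpa using ((hasDerivAt_const s₀ Whᵀ).matrix_mul_s9 hK').matrix_mul_s9 (hasDerivAt_const s₀ Vh)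
  have hR : HasDerivAt (fun s => Vh * (Whᵀ * K s * Vh)⁻¹ * Whᵀ) _ s₀ :=
    ((hasDerivAt_const s₀ Vh).matrix_mul_s9 (hKr'.matrix_inv_s9 hKr)).matrix_mul_s9
      (hasDerivAt_const s₀ Whᵀ)
  have hE := (hD₁.matrix_mul_s9 (hK'.sub ((hK'.matrix_mul_s9 hR).matrix_mul_s9 hK'))).matrix_mul_s9 hD₂
  refine (hE.congr_of_eventuallyEq ?_).congr_deriv ?_
  · filter_upwards [hK'.eventually_isUnit_matrix hK] with s hs
    have hd := (Matrix.isUnit_iff_isUnit_det _).1 hs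
    simp [Matrix.mul_sub, Matrix.sub_mul, Matrix.mul_assoc,
      Matrix.mul_nonsing_inv_cancel_left _ _ hd, Matrix.nonsing_inv_mul_cancel_left _ _ hd]
  · subst hD₃eq
    simp [Matrix.mul_sub, Matrix.sub_mul, Matrix.mul_add, Matrix.add_mul, Matrix.mul_assoc,
      Matrix.mul_nonsing_inv_cancel_left _ _ hdK, Matrix.nonsing_inv_mul_cancel_left _ _ hdK]
    abel
end

section
/- (Exact tangential interpolation.) For each j with Wᵀ * K(σ_j) * V invertible, the reduced model satisfies the right tangential interpolation condition H_r(σ_j) *ᵥ b_j = H(σ_j) *ᵥ b_j; and for each i with Wᵀ * K(μ_i) * V invertible, it satisfies the left tangential interpolation condition c_i ᵥ* H_r(μ_i) = c_i ᵥ* H(μ_i) (equality of row vectors c_iᵀ H_r(μ_i) = c_iᵀ H(μ_i), where x ᵥ* M denotes xᵀM). -/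
open Matrix

/-- A Petrov-Galerkin projection reproduces `C * K⁻¹ * B` along every direction `b` whose
full-order solution `K⁻¹ *ᵥ (B *ᵥ b)` lies in the column space of `V`. -/
theorem Matrix.petrovGalerkin_mulVec_eq {R n m p r : Type*} [CommRing R]
    [Fintype n] [DecidableEq n] [Fintype m] [Fintype r] [DecidableEq r]
    {K : Matrix n n R} (hK : IsUnit K) (B : Matrix n m R) (C : Matrix p n R)
    (V : Matrix n r R) (U : Matrix r n R) (hA : IsUnit (U * K * V)) {b : m → R} {x : r → R}
    (hx : V *ᵥ x = K⁻¹ *ᵥ (B *ᵥ b)) :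
    (C * V * (U * K * V)⁻¹ * U * B) *ᵥ b = (C * K⁻¹ * B) *ᵥ b := by
  have hB : B *ᵥ b = K *ᵥ (V *ᵥ x) := by
    rw [hx, mulVec_mulVec, mul_nonsing_inv _ ((isUnit_iff_isUnit_det K).1 hK), one_mulVec]
  calc (C * V * (U * K * V)⁻¹ * U * B) *ᵥ b
      = (C * V) *ᵥ (((U * K * V)⁻¹ * (U * K * V)) *ᵥ x) := by
        simp only [← mulVec_mulVec, hB]
    _ = (C * K⁻¹ * B) *ᵥ b := by
        rw [nonsing_inv_mul _ ((isUnit_iff_isUnit_det _).1 hA), one_mulVec]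
        simp only [← mulVec_mulVec, hx]

/-- A Petrov-Galerkin projection reproduces `C * K⁻¹ * B` along every left direction `c` whose
full-order adjoint solution lies in the column space of `W`. -/
theorem Matrix.vecMul_petrovGalerkin_eq {R n m p r : Type*} [CommRing R]
    [Fintype n] [DecidableEq n] [Fintype p] [Fintype r] [DecidableEq r]
    {K : Matrix n n R} (hK : IsUnit K) (B : Matrix n m R) (C : Matrix p n R)
    (V W : Matrix n r R) (hA : IsUnit (Wᵀ * K * V)) {c : p → R} {y : r → R}
    (hy : W *ᵥ y = Kᵀ⁻¹ *ᵥ (Cᵀ *ᵥ c)) :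
    c ᵥ* (C * V * (Wᵀ * K * V)⁻¹ * Wᵀ * B) = c ᵥ* (C * K⁻¹ * B) := by
  have hA' : IsUnit (Vᵀ * Kᵀ * W) := by
    simpa [Matrix.mul_assoc] using (isUnit_transpose _).2 hA
  have h := petrovGalerkin_mulVec_eq ((isUnit_transpose K).2 hK) Cᵀ Bᵀ W Vᵀ hA' hy
  rw [← mulVec_transpose, ← mulVec_transpose]
  simpa [Matrix.mul_assoc, transpose_nonsing_inv] using h

/-- Exact interpolatory model reduction satisfies the left and right tangential
interpolation conditions. -/
theorem exact_tangential_interpolation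
    {n m p r : ℕ} (hn : 0 < n) (hm : 0 < m) (hp : 0 < p) (hr : 0 < r)
    (K : ℂ → Matrix (Fin n) (Fin n) ℂ)
    (B : ℂ → Matrix (Fin n) (Fin m) ℂ)
    (C : ℂ → Matrix (Fin p) (Fin n) ℂ)
    (σ μ : Fin r → ℂ)
    (b : Fin r → Fin m → ℂ) (c : Fin r → Fin p → ℂ)
    (hKσ : ∀ j, IsUnit (K (σ j))) (hKμ : ∀ i, IsUnit (K (μ i)))
    (V W : Matrix (Fin n) (Fin r) ℂ)
    (hV : ∀ j, (fun i => V i j) = (K (σ j))⁻¹ *ᵥ (B (σ j) *ᵥ b j))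
    (hW : ∀ i, (fun k => W k i) = ((K (μ i))ᵀ)⁻¹ *ᵥ ((C (μ i))ᵀ *ᵥ c i))
    (H Hr : ℂ → Matrix (Fin p) (Fin m) ℂ)
    (hH : H = fun s => C s * (K s)⁻¹ * B s)
    (hHr : Hr = fun s => C s * V * (Wᵀ * K s * V)⁻¹ * Wᵀ * B s) :
    (∀ j, IsUnit (Wᵀ * K (σ j) * V) → Hr (σ j) *ᵥ b j = H (σ j) *ᵥ b j) ∧
    (∀ i, IsUnit (Wᵀ * K (μ i) * V) → c i ᵥ* Hr (μ i) = c i ᵥ* H (μ i)) := by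
  subst hH hHr
  refine ⟨fun j hA => petrovGalerkin_mulVec_eq (hKσ j) _ _ V Wᵀ hA (x := Pi.single j 1) ?_,
    fun i hA => vecMul_petrovGalerkin_eq (hKμ i) _ _ V W hA (y := Pi.single i 1) ?_⟩
  · rw [mulVec_single_one]
    exact hV j
  · rw [mulVec_single_one]
    exact hW i
end

section
/- (Theorem 2.) Suppose ‖η_j‖ ≤ ε · ‖B(σ_j) *ᵥ b_j‖ for every j, where ε > 0, and that B(σ_j) *ᵥ b_j ≠ 0 and (K(σ_j))⁻¹ ≠ 0 for every j. Let D_v be the r×r diagonal matrix with j-th diagonal entry (‖(K(σ_j))⁻¹‖ · ‖B(σ_j) *ᵥ b_j‖)⁻¹, and assume σmin(V̂ * D_v) > 0. Then for every vector v̂ in the column span of V̂ there exists a vector v in the column span of V such that ‖v − v̂‖ ≤ (ε * Real.sqrt r / σmin(V̂ * D_v)) * ‖v̂‖; equivalently, the sine of the largest angle from span(V̂) to span(V) is at most ε√r / σmin(V̂ D_v). -/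
open Matrix

/-- Smallest singular value of a matrix. -/
noncomputable def smin {k l : ℕ} (M : Matrix (Fin k) (Fin l) ℂ) : ℝ :=
  sInf {t : ℝ | ∃ x : Fin l → ℂ, vnorm x = 1 ∧ t = vnorm (M *ᵥ x)}

theorem vnorm_smul {k : ℕ} (c : ℂ) (x : Fin k → ℂ) : vnorm (c • x) = ‖c‖ * vnorm x := by
  simp [vnorm, norm_smul]

theorem vnorm_sum_le {k : ℕ} {ι : Type*} (s : Finset ι) (f : ι → Fin k → ℂ) :
    vnorm (∑ i ∈ s, f i) ≤ ∑ i ∈ s, vnorm (f i) := by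
  simp only [vnorm, WithLp.equiv_symm_apply, WithLp.toLp_sum]
  exact norm_sum_le _ _

theorem vnorm_nonneg {k : ℕ} (x : Fin k → ℂ) : 0 ≤ vnorm x := norm_nonneg _

theorem vnorm_pos {k : ℕ} {x : Fin k → ℂ} (hx : x ≠ 0) : 0 < vnorm x := by
  simpa [vnorm] using hx

theorem mnorm_pos {k l : ℕ} {M : Matrix (Fin k) (Fin l) ℂ} (hM : M ≠ 0) : 0 < mnorm M := by
  simpa [mnorm] using hM

theorem smin_mul_vnorm_le {k l : ℕ} (M : Matrix (Fin k) (Fin l) ℂ) (x : Fin l → ℂ) :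
    smin M * vnorm x ≤ vnorm (M *ᵥ x) := by
  rcases eq_or_ne x 0 with rfl | hx
  · simp [vnorm]
  have hpos := vnorm_pos hx
  have hnorm : ‖((vnorm x : ℂ))⁻¹‖ = (vnorm x)⁻¹ := by
    rw [norm_inv, Complex.norm_real, Real.norm_of_nonneg hpos.le]
  have h : smin M ≤ vnorm (M *ᵥ ((vnorm x : ℂ)⁻¹ • x)) := by
    refine csInf_le ⟨0, ?_⟩ ⟨_, ?_, rfl⟩
    · rintro t ⟨y, -, rfl⟩
      exact vnorm_nonneg _
    · rw [vnorm_smul, hnorm, inv_mul_cancel₀ hpos.ne']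
  rwa [Matrix.mulVec_smul, vnorm_smul, hnorm, inv_mul_eq_div, le_div_iff₀ hpos] at h

theorem sum_norm_le_sqrt_mul_vnorm {k : ℕ} (x : Fin k → ℂ) :
    ∑ i, ‖x i‖ ≤ Real.sqrt k * vnorm x := by
  have h := Real.sum_mul_le_sqrt_mul_sqrt Finset.univ (fun _ : Fin k => (1 : ℝ)) (fun i => ‖x i‖)
  simpa [vnorm, EuclideanSpace.norm_eq] using h

/-- Theorem 2: bound on the angle between the exact and the inexact interpolatory
subspaces, in terms of the relative residual tolerance `ε`. -/
theorem inexact_subspace_angle_bound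
    {n m r : ℕ} (hn : 0 < n) (hm : 0 < m) (hr : 0 < r)
    (ε : ℝ) (hε : 0 < ε)
    (K : ℂ → Matrix (Fin n) (Fin n) ℂ)
    (B : ℂ → Matrix (Fin n) (Fin m) ℂ)
    (σ : Fin r → ℂ) (b : Fin r → Fin m → ℂ)
    (hK : ∀ j, IsUnit (K (σ j)))
    (v vh η : Fin r → Fin n → ℂ)
    (hv : ∀ j, v j = (K (σ j))⁻¹ *ᵥ (B (σ j) *ᵥ b j))
    (hη : ∀ j, η j = K (σ j) *ᵥ vh j - B (σ j) *ᵥ b j)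
    (hres : ∀ j, vnorm (η j) ≤ ε * vnorm (B (σ j) *ᵥ b j))
    (hB : ∀ j, B (σ j) *ᵥ b j ≠ 0)
    (hKinv : ∀ j, (K (σ j))⁻¹ ≠ 0)
    (V Vh : Matrix (Fin n) (Fin r) ℂ)
    (hVcol : ∀ j i, V i j = v j i) (hVhcol : ∀ j i, Vh i j = vh j i)
    (Dv : Matrix (Fin r) (Fin r) ℂ)
    (hDv : Dv = Matrix.diagonal fun j =>
      (((mnorm ((K (σ j))⁻¹) * vnorm (B (σ j) *ᵥ b j))⁻¹ : ℝ) : ℂ))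
    (hsmin : 0 < smin (Vh * Dv)) :
    ∀ x ∈ Submodule.span ℂ (Set.range fun j : Fin r => fun i : Fin n => Vh i j),
      ∃ y ∈ Submodule.span ℂ (Set.range fun j : Fin r => fun i : Fin n => V i j),
        vnorm (y - x) ≤ (ε * Real.sqrt r / smin (Vh * Dv)) * vnorm x := by
  intro x hx
  set p : Fin r → ℝ := fun j => mnorm ((K (σ j))⁻¹) * vnorm (B (σ j) *ᵥ b j)
  have hp_pos : ∀ j, 0 < p j := fun j => mul_pos (mnorm_pos (hKinv j)) (vnorm_pos (hB j))
  obtain ⟨c, rfl⟩ := (Submodule.mem_span_range_iff_exists_fun ℂ).1 hx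
  refine ⟨∑ j, c j • fun i => V i j, Submodule.sum_mem _ fun j _ =>
    Submodule.smul_mem _ _ (Submodule.subset_span ⟨j, rfl⟩), ?_⟩
  set z : Fin r → ℂ := fun j => (p j : ℂ) * c j with hz
  have hVh : (∑ j, c j • fun i => Vh i j) = (Vh * Dv) *ᵥ z := by
    have hDz : Dv *ᵥ z = c := by
      ext j
      rw [hDv, Matrix.mulVec_diagonal, Complex.ofReal_inv]
      exact inv_mul_cancel_left₀ (Complex.ofReal_ne_zero.2 (hp_pos j).ne') _
    rw [← Matrix.mulVec_mulVec, hDz]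
    ext i
    simp [Matrix.mulVec, dotProduct, mul_comm]
  have hcol : ∀ j, vnorm (v j - vh j) ≤ ε * p j := by
    intro j
    have hdet : IsUnit (K (σ j)).det := (Matrix.isUnit_iff_isUnit_det _).1 (hK j)
    have hdiff : v j - vh j = (-1 : ℂ) • ((K (σ j))⁻¹ *ᵥ η j) := by
      rw [hη, Matrix.mulVec_sub, ← hv, Matrix.mulVec_mulVec, Matrix.nonsing_inv_mul _ hdet,
        Matrix.one_mulVec, neg_one_smul, neg_sub]
    calc vnorm (v j - vh j) = vnorm ((K (σ j))⁻¹ *ᵥ η j) := by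
          rw [hdiff, vnorm_smul, norm_neg, norm_one, one_mul]
      _ ≤ mnorm ((K (σ j))⁻¹) * vnorm (η j) := vnorm_mulVec_le _ _
      _ ≤ mnorm ((K (σ j))⁻¹) * (ε * vnorm (B (σ j) *ᵥ b j)) :=
          mul_le_mul_of_nonneg_left (hres j) (mnorm_pos (hKinv j)).le
      _ = ε * p j := mul_left_comm _ _ _
  have hsub : (∑ j, c j • fun i => V i j) - (∑ j, c j • fun i => Vh i j)
      = ∑ j, c j • (v j - vh j) := by
    simp only [hVcol, hVhcol, smul_sub, Finset.sum_sub_distrib]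
  calc vnorm ((∑ j, c j • fun i => V i j) - ∑ j, c j • fun i => Vh i j)
      ≤ ∑ j, vnorm (c j • (v j - vh j)) := hsub ▸ vnorm_sum_le _ _
    _ ≤ ∑ j, ε * ‖z j‖ := by
        refine Finset.sum_le_sum fun j _ => ?_
        rw [vnorm_smul, hz, norm_mul, Complex.norm_real, Real.norm_of_nonneg (hp_pos j).le,
          ← mul_assoc, mul_comm]
        exact mul_le_mul_of_nonneg_right (hcol j) (norm_nonneg _)
    _ ≤ ε * (Real.sqrt r * vnorm z) := by
        rw [← Finset.mul_sum]
        exact mul_le_mul_of_nonneg_left (sum_norm_le_sqrt_mul_vnorm z) hε.le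
    _ ≤ ε * Real.sqrt r / smin (Vh * Dv) * vnorm (∑ j, c j • fun i => Vh i j) := by
        rw [hVh, ← mul_assoc, div_mul_eq_mul_div, mul_div_assoc]
        refine mul_le_mul_of_nonneg_left ?_ (by positivity)
        rw [le_div_iff₀ hsmin, mul_comm]
        exact smin_mul_vnorm_le _ _
end

section
/- (Theorem 4, backward perturbation constraints.) Assume the Petrov–Galerkin orthogonality conditions W̃ᵀ * R_b = 0 and R_cᵀ * Ṽ = 0. Then the rank-≤2r matrix F₂ᵣ satisfies F₂ᵣ * Ṽ = R_b, W̃ᵀ * F₂ᵣ = R_cᵀ, and W̃ᵀ * F₂ᵣ * Ṽ = 0. -/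
open Matrix

/-- Theorem 4 (backward perturbation constraints): under the Petrov–Galerkin
orthogonality conditions, the rank-≤2r perturbation `F₂ᵣ` satisfies the required
constraints. -/
theorem backward_perturbation_constraints
    {n m p r : ℕ} (hn : 0 < n) (hm : 0 < m) (hp : 0 < p) (hr : 0 < r)
    (K : ℂ → Matrix (Fin n) (Fin n) ℂ)
    (B : ℂ → Matrix (Fin n) (Fin m) ℂ)
    (C : ℂ → Matrix (Fin p) (Fin n) ℂ)
    (σ : Fin r → ℂ)
    (b : Fin r → Fin m → ℂ) (c : Fin r → Fin p → ℂ)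
    (vt wt : Fin r → Fin n → ℂ)
    (η ξ : Fin r → Fin n → ℂ)
    (hη : ∀ j, η j = K (σ j) *ᵥ vt j - B (σ j) *ᵥ b j)
    (hξ : ∀ j, ξ j = (K (σ j))ᵀ *ᵥ wt j - (C (σ j))ᵀ *ᵥ c j)
    (Vt Wt Rb Rc : Matrix (Fin n) (Fin r) ℂ)
    (hVt : ∀ j i, Vt i j = vt j i) (hWt : ∀ j i, Wt i j = wt j i)
    (hRb : ∀ j i, Rb i j = η j i) (hRc : ∀ j i, Rc i j = ξ j i)
    (hinv : IsUnit (Wtᵀ * Vt))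
    (F : Matrix (Fin n) (Fin n) ℂ)
    (hF : F = Rb * (Wtᵀ * Vt)⁻¹ * Wtᵀ + Vt * (Wtᵀ * Vt)⁻¹ * Rcᵀ)
    (hPGb : Wtᵀ * Rb = 0) (hPGc : Rcᵀ * Vt = 0) :
    F * Vt = Rb ∧ Wtᵀ * F = Rcᵀ ∧ Wtᵀ * F * Vt = 0 := by
  have hdet : IsUnit (Wtᵀ * Vt).det := (Matrix.isUnit_iff_isUnit_det _).mp hinv
  have hFV : F * Vt = Rb := by
    rw [hF, Matrix.add_mul, Matrix.mul_assoc _ Wtᵀ, Matrix.mul_assoc _ Rcᵀ, hPGc,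
      Matrix.nonsing_inv_mul_cancel_right _ _ hdet, Matrix.mul_zero, add_zero]
  refine ⟨hFV, ?_, ?_⟩
  · rw [hF, Matrix.mul_add, Matrix.mul_assoc Rb, ← Matrix.mul_assoc Wtᵀ Rb, hPGb,
      Matrix.zero_mul, zero_add, ← Matrix.mul_assoc, ← Matrix.mul_assoc,
      Matrix.mul_nonsing_inv _ hdet, Matrix.one_mul]
  · rw [Matrix.mul_assoc, hFV, hPGb]
end

section
/- (Theorem 4, backward stability.) Assume the Petrov–Galerkin orthogonality conditions W̃ᵀ * R_b = 0 and R_cᵀ * Ṽ = 0. Then for each j the inexact vectors solve the interpolation equations of the perturbed full-order system K̃(s) := K(s) − F₂ᵣ exactly: (K(σ_j) − F₂ᵣ) *ᵥ ṽ_j = B(σ_j) *ᵥ b_j and (K(σ_j) − F₂ᵣ)ᵀ *ᵥ w̃_j = (C(σ_j))ᵀ *ᵥ c_j; moreover W̃ᵀ * (K(s) − F₂ᵣ) * Ṽ = W̃ᵀ * K(s) * Ṽ for every s ∈ ℂ, so the inexact reduced-order model built from Ṽ and W̃ coincides with the exact interpolatory reduced model of the perturbed system K̃. -/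
open Matrix

/-- Theorem 4 (backward stability): under Petrov–Galerkin orthogonality, the inexact
vectors exactly solve the interpolation equations of the perturbed system
`K̃(s) = K(s) - F₂ᵣ`, and the inexact reduced model coincides with the exact
interpolatory reduced model of the perturbed system. -/
theorem petrov_galerkin_backward_stability
    {n m p r : ℕ} (hn : 0 < n) (hm : 0 < m) (hp : 0 < p) (hr : 0 < r)
    (K : ℂ → Matrix (Fin n) (Fin n) ℂ)
    (B : ℂ → Matrix (Fin n) (Fin m) ℂ)
    (C : ℂ → Matrix (Fin p) (Fin n) ℂ)
    (σ : Fin r → ℂ)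
    (b : Fin r → Fin m → ℂ) (c : Fin r → Fin p → ℂ)
    (vt wt : Fin r → Fin n → ℂ)
    (η ξ : Fin r → Fin n → ℂ)
    (hη : ∀ j, η j = K (σ j) *ᵥ vt j - B (σ j) *ᵥ b j)
    (hξ : ∀ j, ξ j = (K (σ j))ᵀ *ᵥ wt j - (C (σ j))ᵀ *ᵥ c j)
    (Vt Wt Rb Rc : Matrix (Fin n) (Fin r) ℂ)
    (hVt : ∀ j i, Vt i j = vt j i) (hWt : ∀ j i, Wt i j = wt j i)
    (hRb : ∀ j i, Rb i j = η j i) (hRc : ∀ j i, Rc i j = ξ j i)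
    (hinv : IsUnit (Wtᵀ * Vt))
    (F : Matrix (Fin n) (Fin n) ℂ)
    (hF : F = Rb * (Wtᵀ * Vt)⁻¹ * Wtᵀ + Vt * (Wtᵀ * Vt)⁻¹ * Rcᵀ)
    (hPGb : Wtᵀ * Rb = 0) (hPGc : Rcᵀ * Vt = 0) :
    (∀ j, (K (σ j) - F) *ᵥ vt j = B (σ j) *ᵥ b j) ∧
    (∀ j, (K (σ j) - F)ᵀ *ᵥ wt j = (C (σ j))ᵀ *ᵥ c j) ∧
    (∀ s : ℂ, Wtᵀ * (K s - F) * Vt = Wtᵀ * K s * Vt) := by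
  have hdet : IsUnit (Wtᵀ * Vt).det := (Matrix.isUnit_iff_isUnit_det _).mp hinv
  have hFV : F * Vt = Rb := by
    rw [hF, Matrix.add_mul, Matrix.mul_assoc _ Wtᵀ Vt, Matrix.mul_assoc _ Rcᵀ Vt, hPGc,
      Matrix.mul_zero, add_zero, Matrix.nonsing_inv_mul_cancel_right _ _ hdet]
  have hWF : Wtᵀ * F = Rcᵀ := by
    rw [hF, Matrix.mul_add, Matrix.mul_assoc Rb, ← Matrix.mul_assoc Wtᵀ Rb, hPGb,
      Matrix.zero_mul, zero_add, Matrix.mul_assoc Vt, ← Matrix.mul_assoc Wtᵀ Vt,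
      Matrix.mul_nonsing_inv_cancel_left _ _ hdet]
  have hFW : Fᵀ * Wt = Rc := by
    simpa using congrArg Matrix.transpose hWF
  refine ⟨fun j => ?_, fun j => ?_, fun s => ?_⟩
  · have hv : vt j = Vt.col j := funext fun i => (hVt j i).symm
    have hFv : F *ᵥ vt j = η j := by
      ext i
      rw [hv, ← hRb, ← hFV]
      rfl
    rw [Matrix.sub_mulVec, hFv, hη, sub_sub_cancel]
  · have hw : wt j = Wt.col j := funext fun i => (hWt j i).symm
    have hFw : Fᵀ *ᵥ wt j = ξ j := by
      ext i
      rw [hw, ← hRc, ← hFW]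
      rfl
    rw [Matrix.transpose_sub, Matrix.sub_mulVec, hFw, hξ, sub_sub_cancel]
  · rw [Matrix.mul_sub, Matrix.sub_mul, hWF, hPGc, sub_zero]
end

section
/- (Loewner structure of the exact interpolatory reduced model.) For all indices i ≠ j: (Wᵀ * E * V)_{ij} = −( c_iᵀH(σ_i)b_j − c_iᵀH(σ_j)b_j ) / (σ_i − σ_j) and (Wᵀ * A * V)_{ij} = −( σ_i · c_iᵀH(σ_i)b_j − σ_j · c_iᵀH(σ_j)b_j ) / (σ_i − σ_j); moreover, for every i and k, (Wᵀ * B)_{ik} = (c_i ᵥ* H(σ_i))_k (the i-th row of Wᵀ B is the row vector c_iᵀ H(σ_i)), and for every j the j-th column of C * V is H(σ_j) *ᵥ b_j. Here c_iᵀH(σ)b_j denotes the scalar c_i ⬝ᵥ (H(σ) *ᵥ b_j). -/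
open Matrix

namespace Matrix

variable {R l n o : Type*} [CommRing R] [Fintype n]

theorem transpose_mul_mul_apply (W : Matrix n l R) (M : Matrix n n R) (V : Matrix n o R)
    (i : l) (j : o) :
    (Wᵀ * M * V) i j = (fun k => W k i) ⬝ᵥ (M *ᵥ fun k => V k j) := by
  rw [Matrix.mul_assoc]
  rfl

variable [DecidableEq n]

/-- Resolvent identity for a matrix pencil, weighted by its leading coefficient. -/
theorem sub_smul_inv_pencil_mul_mul_inv (E A : Matrix n n R) {s t : R}
    (hs : IsUnit (s • E - A)) (ht : IsUnit (t • E - A)) :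
    (s - t) • ((s • E - A)⁻¹ * E * (t • E - A)⁻¹) = (t • E - A)⁻¹ - (s • E - A)⁻¹ := by
  have h : (s - t) • E = (s • E - A) - (t • E - A) := by module
  rw [← Matrix.smul_mul, ← Matrix.mul_smul, h, Matrix.mul_sub, Matrix.sub_mul,
    nonsing_inv_mul _ ((isUnit_iff_isUnit_det _).1 hs), Matrix.one_mul,
    Matrix.mul_assoc, mul_nonsing_inv _ ((isUnit_iff_isUnit_det _).1 ht), Matrix.mul_one]

/-- Resolvent identity for a matrix pencil, weighted by its constant coefficient. -/
theorem sub_smul_inv_pencil_mul_mul_inv' (E A : Matrix n n R) {s t : R}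
    (hs : IsUnit (s • E - A)) (ht : IsUnit (t • E - A)) :
    (s - t) • ((s • E - A)⁻¹ * A * (t • E - A)⁻¹) =
      t • (t • E - A)⁻¹ - s • (s • E - A)⁻¹ := by
  have h : (s - t) • A = t • (s • E - A) - s • (t • E - A) := by module
  rw [← Matrix.smul_mul, ← Matrix.mul_smul, h, Matrix.mul_sub, Matrix.sub_mul,
    Matrix.mul_smul, Matrix.mul_smul, Matrix.smul_mul, Matrix.smul_mul,
    nonsing_inv_mul _ ((isUnit_iff_isUnit_det _).1 hs), Matrix.one_mul,
    Matrix.mul_assoc, mul_nonsing_inv _ ((isUnit_iff_isUnit_det _).1 ht), Matrix.mul_one]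

end Matrix

/-- Loewner structure of the exact interpolatory reduced model (Mayo–Antoulas):
off-diagonal entries of `Wᵀ E V` and `Wᵀ A V` are (negated) Loewner and shifted
Loewner quotients, and `Wᵀ B`, `C V` consist of the tangential samples. -/
theorem loewner_structure_of_exact_interpolant
    {n m p r : ℕ} (hn : 0 < n) (hm : 0 < m) (hp : 0 < p) (hr : 0 < r)
    (E A : Matrix (Fin n) (Fin n) ℂ)
    (B : Matrix (Fin n) (Fin m) ℂ)
    (C : Matrix (Fin p) (Fin n) ℂ)
    (σ : Fin r → ℂ) (hσ : Function.Injective σ)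
    (hinv : ∀ j, IsUnit (σ j • E - A))
    (b : Fin r → Fin m → ℂ) (c : Fin r → Fin p → ℂ)
    (H : ℂ → Matrix (Fin p) (Fin m) ℂ)
    (hH : H = fun s => C * (s • E - A)⁻¹ * B)
    (V W : Matrix (Fin n) (Fin r) ℂ)
    (hV : ∀ j, (fun i => V i j) = (σ j • E - A)⁻¹ *ᵥ (B *ᵥ b j))
    (hW : ∀ i, (fun k => W k i) = ((σ i • E - A)ᵀ)⁻¹ *ᵥ (Cᵀ *ᵥ c i)) :
    (∀ i j, i ≠ j →
        (Wᵀ * E * V) i j =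
          -((c i ⬝ᵥ (H (σ i) *ᵥ b j) - c i ⬝ᵥ (H (σ j) *ᵥ b j)) / (σ i - σ j))) ∧
    (∀ i j, i ≠ j →
        (Wᵀ * A * V) i j =
          -((σ i * (c i ⬝ᵥ (H (σ i) *ᵥ b j)) - σ j * (c i ⬝ᵥ (H (σ j) *ᵥ b j))) /
            (σ i - σ j))) ∧
    (∀ i k, (Wᵀ * B) i k = (c i ᵥ* H (σ i)) k) ∧
    (∀ j i, (C * V) i j = (H (σ j) *ᵥ b j) i) := by
  have hW' (i : Fin r) : (fun k => W k i) = c i ᵥ* (C * (σ i • E - A)⁻¹) := by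
    rw [hW, ← transpose_nonsing_inv, mulVec_transpose, mulVec_transpose, vecMul_vecMul]
  have hM (M : Matrix (Fin n) (Fin n) ℂ) (i j : Fin r) : (Wᵀ * M * V) i j =
      c i ⬝ᵥ ((C * ((σ i • E - A)⁻¹ * M * (σ j • E - A)⁻¹) * B) *ᵥ b j) := by
    rw [transpose_mul_mul_apply, hV, hW', ← dotProduct_mulVec]
    simp only [mulVec_mulVec, Matrix.mul_assoc]
  have hsmul (a : ℂ) (X : Matrix (Fin n) (Fin n) ℂ) (i j : Fin r) :
      a * (c i ⬝ᵥ ((C * X * B) *ᵥ b j)) = c i ⬝ᵥ ((C * (a • X) * B) *ᵥ b j) := by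
    rw [Matrix.mul_smul, Matrix.smul_mul, smul_mulVec, dotProduct_smul, smul_eq_mul]
  have hsub (X Y : Matrix (Fin n) (Fin n) ℂ) (i j : Fin r) :
      c i ⬝ᵥ ((C * X * B) *ᵥ b j) - c i ⬝ᵥ ((C * Y * B) *ᵥ b j) =
        c i ⬝ᵥ ((C * (X - Y) * B) *ᵥ b j) := by
    rw [Matrix.mul_sub, Matrix.sub_mul, sub_mulVec, dotProduct_sub]
  subst hH
  beta_reduce
  refine ⟨fun i j hij => ?_, fun i j hij => ?_, fun i k => ?_, fun j i => ?_⟩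
  · rw [← neg_div, eq_div_iff (sub_ne_zero.2 (hσ.ne hij)), mul_comm, hM, neg_sub, hsub, hsmul,
      sub_smul_inv_pencil_mul_mul_inv E A (hinv i) (hinv j)]
  · rw [← neg_div, eq_div_iff (sub_ne_zero.2 (hσ.ne hij)), mul_comm, hM, neg_sub, hsmul, hsmul,
      hsmul, hsub, sub_smul_inv_pencil_mul_mul_inv' E A (hinv i) (hinv j)]
  · change ((fun k => W k i) ᵥ* B) k = _
    rw [hW', vecMul_vecMul]
  · change (C *ᵥ fun k => V k j) i = _
    rw [hV, mulVec_mulVec, mulVec_mulVec, Matrix.mul_assoc]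
end

section
/- (Structure of exact and inexact interpolants when E = I.) Let Σ be the r×r diagonal matrix with diagonal entries σ_1, …, σ_r and let B★ be the m×r matrix whose j-th column is b_j. (i) If the columns of V are the exact solutions v_j = (σ_j • 1 − A)⁻¹ *ᵥ (B *ᵥ b_j) and Wᵀ * V is invertible, then with Q := (Wᵀ * V)⁻¹ * Wᵀ * B one has (Wᵀ * V)⁻¹ * (Wᵀ * A * V) = Σ − Q * B★. (ii) If instead the columns of Ṽ are inexact solutions ṽ_j with residuals η_j := (σ_j • 1 − A) *ᵥ ṽ_j − B *ᵥ b_j satisfying the Petrov–Galerkin conditions W̃ᵀ *ᵥ η_j = 0 for every j, and W̃ᵀ * Ṽ is invertible, then with Q̃ := (W̃ᵀ * Ṽ)⁻¹ * W̃ᵀ * B one has (W̃ᵀ * Ṽ)⁻¹ * (W̃ᵀ * A * Ṽ) = Σ − Q̃ * B★. -/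
open Matrix

/-- If the columns of `V` solve the shifted systems `(σ j • 1 - A) v = B b` up to residuals
annihilated by `L`, then the reduced matrix is a diagonal matrix minus a low-rank term, up to
normalization by `L * V`. -/
theorem inv_mul_mul_eq_diagonal_sub_of_petrovGalerkin
    {K ι κ ρ : Type*} [CommRing K] [Fintype ι] [DecidableEq ι] [Fintype κ] [Fintype ρ]
    [DecidableEq ρ] (A : Matrix ι ι K) (B : Matrix ι κ K) (σ : ρ → K) (R : Matrix κ ρ K)
    (V : Matrix ι ρ K) (L : Matrix ρ ι K)
    (h : ∀ j, L *ᵥ ((σ j • (1 : Matrix ι ι K) - A) *ᵥ V.col j - B *ᵥ R.col j) = 0)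
    (hLV : IsUnit (L * V)) :
    (L * V)⁻¹ * (L * A * V) = diagonal σ - ((L * V)⁻¹ * L * B) * R := by
  have key : L * A * V = L * V * diagonal σ - L * B * R := by
    ext i j
    have hij := congrFun (h j) i
    rw [sub_mulVec, smul_mulVec, one_mulVec, mulVec_sub, mulVec_sub, mulVec_smul] at hij
    have hA : (L * A * V) i j = (L *ᵥ (A *ᵥ V.col j)) i := by
      rw [mulVec_mulVec]; rfl
    have hB : (L * B * R) i j = (L *ᵥ (B *ᵥ R.col j)) i := by
      rw [mulVec_mulVec]; rfl
    have hV : (L * V) i j = (L *ᵥ V.col j) i := rfl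
    rw [Matrix.sub_apply, mul_diagonal, hA, hB, hV]
    simp only [Pi.sub_apply, Pi.smul_apply, smul_eq_mul, Pi.zero_apply] at hij
    linear_combination -hij
  rw [key, Matrix.mul_sub, ← Matrix.mul_assoc, nonsing_inv_mul _ ((isUnit_iff_isUnit_det _).mp hLV),
    Matrix.one_mul]
  simp only [Matrix.mul_assoc]

/-- Structure of exact and inexact (Petrov–Galerkin) interpolants when `E = I`:
the normalized reduced matrix is a diagonal matrix of interpolation points minus a
low-rank term. -/
theorem interpolant_structure_E_eq_id
    {n m p r : ℕ} (hn : 0 < n) (hm : 0 < m) (hp : 0 < p) (hr : 0 < r)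
    (A : Matrix (Fin n) (Fin n) ℂ)
    (B : Matrix (Fin n) (Fin m) ℂ)
    (C : Matrix (Fin p) (Fin n) ℂ)
    (σ : Fin r → ℂ) (hinv : ∀ j, IsUnit (σ j • (1 : Matrix (Fin n) (Fin n) ℂ) - A))
    (b : Fin r → Fin m → ℂ)
    (Sig : Matrix (Fin r) (Fin r) ℂ) (hSig : Sig = Matrix.diagonal σ)
    (Bstar : Matrix (Fin m) (Fin r) ℂ) (hBstar : ∀ j k, Bstar k j = b j k)
    -- (i) exact interpolant
    (V W : Matrix (Fin n) (Fin r) ℂ)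
    (hV : ∀ j, (fun i => V i j) = (σ j • (1 : Matrix (Fin n) (Fin n) ℂ) - A)⁻¹ *ᵥ (B *ᵥ b j))
    -- (ii) inexact interpolant with Petrov–Galerkin residuals
    (Vt Wt : Matrix (Fin n) (Fin r) ℂ)
    (η : Fin r → Fin n → ℂ)
    (hη : ∀ j, η j = (σ j • (1 : Matrix (Fin n) (Fin n) ℂ) - A) *ᵥ (fun i => Vt i j) -
      B *ᵥ b j)
    (hPG : ∀ j, Wtᵀ *ᵥ η j = 0) :
    (IsUnit (Wᵀ * V) →
      (Wᵀ * V)⁻¹ * (Wᵀ * A * V) = Sig - ((Wᵀ * V)⁻¹ * Wᵀ * B) * Bstar) ∧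
    (IsUnit (Wtᵀ * Vt) →
      (Wtᵀ * Vt)⁻¹ * (Wtᵀ * A * Vt) = Sig - ((Wtᵀ * Vt)⁻¹ * Wtᵀ * B) * Bstar) := by
  have hcol : ∀ j, Bstar.col j = b j := fun j => funext fun k => hBstar j k
  subst hSig
  constructor
  · refine inv_mul_mul_eq_diagonal_sub_of_petrovGalerkin A B σ Bstar V Wᵀ fun j => ?_
    have hVj : V.col j = (σ j • (1 : Matrix (Fin n) (Fin n) ℂ) - A)⁻¹ *ᵥ (B *ᵥ b j) := hV j
    rw [hcol, hVj, mulVec_mulVec, mul_nonsing_inv _ ((isUnit_iff_isUnit_det _).mp (hinv j)),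
      one_mulVec, sub_self, mulVec_zero]
  · refine inv_mul_mul_eq_diagonal_sub_of_petrovGalerkin A B σ Bstar Vt Wtᵀ fun j => ?_
    rw [hcol, ← hPG j, hη j]
    rfl
end
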